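/- Flow decomposition underlying the arc-flow/path-flow equivalence (equations (10)–(12)): let V be a finite type, o d : V with o ≠ d, D ≥ 0, and x : V → V → ℝ a nonnegative arc flow (x i j ≥ 0 for all i, j) whose support relation (i, j) ↦ (x i j > 0) admits no directed cycle, and which satisfies the flow-conservation constraints: for every i, Σ_{j} x i j − Σ_{j} x j i equals D if i = o, equals −D if i = d, and equals 0 otherwise. Then there exist finitely many directed paths p 1, …, p m from o to d (each a list of distinct vertices starting at o and ending at d whose consecutive pairs lie in the support of x) and nonnegative weights μ 1, …, μ m such that for all i, j: x i j = Σ_{k} μ k · (if (i, j) is a consecutive pair of p k then 1 else 0). -/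

import Mathlib

theorem List.rel_of_mem_zip_tail {α : Type*} {r : α → α → Prop} {l : List α}
    (hl : l.IsChain r) {i j : α} (h : (i, j) ∈ l.zip l.tail) : r i j := by
  induction l with
  | nil => simp at h
  | cons a l ih =>
    cases l with
    | nil => simp at h
    | cons b l =>
      rw [List.isChain_cons_cons] at hl
      simp only [List.tail_cons, List.zip_cons_cons, List.mem_cons, Prod.mk.injEq] at h
      rcases h with ⟨rfl, rfl⟩ | h
      · exact hl.1
      · exact ih hl.2 h

theorem List.IsChain.nodup_of_acyclic {α : Type*} {r : α → α → Prop} {l : List α}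
    (hr : ∀ i, ¬ Relation.TransGen r i i) (hl : l.IsChain r) : l.Nodup := by
  have h : l.IsChain (Relation.TransGen r) := hl.imp fun _ _ => Relation.TransGen.single
  rw [List.isChain_iff_pairwise] at h
  refine List.Pairwise.imp ?_ h
  rintro a _ hab rfl
  exact hr a hab

theorem List.Nodup.sum_zip_tail_sub {V : Type*} [Fintype V] [DecidableEq V] (i : V) {a : V}
    {l : List V} (hl : (a :: l).Nodup) :
    (∑ j, if (i, j) ∈ (a :: l).zip l then (1 : ℝ) else 0) -
        (∑ j, if (j, i) ∈ (a :: l).zip l then (1 : ℝ) else 0) =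
      (if i = a then 1 else 0) - (if i = (a :: l).getLast (by simp) then 1 else 0) := by
  induction l generalizing a with
  | nil => by_cases h : i = a <;> simp [h]
  | cons b l ih =>
    have hsplit : ∀ u v : V, (if (u, v) ∈ (a :: b :: l).zip (b :: l) then (1 : ℝ) else 0) =
        (if u = a ∧ v = b then 1 else 0) + if (u, v) ∈ (b :: l).zip l then 1 else 0 := by
      intro u v
      have ha : (u, v) ∈ (b :: l).zip l → u ≠ a := by
        rintro h rfl
        exact (List.nodup_cons.1 hl).1 (List.of_mem_zip h).1
      simp only [List.zip_cons_cons, List.mem_cons, Prod.mk.injEq]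
      by_cases h : (u, v) ∈ (b :: l).zip l
      · simp [h, ha h]
      · simp [h]
    have hout : (∑ j, if i = a ∧ j = b then (1 : ℝ) else 0) = if i = a then 1 else 0 := by
      by_cases h : i = a <;> simp [h]
    have hin : (∑ j, if j = a ∧ i = b then (1 : ℝ) else 0) = if i = b then 1 else 0 := by
      by_cases h : i = b <;> simp [h]
    have := ih (List.nodup_cons.1 hl).2
    simp only [hsplit, Finset.sum_add_distrib, hout, hin]
    rw [List.getLast_cons (by simp)]
    linarith

theorem Relation.ReflTransGen.of_acyclic_of_forall_exists {V : Type*} [Finite V]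
    {r : V → V → Prop} (hr : ∀ i, ¬ Relation.TransGen r i i) {t : V}
    (hstep : ∀ u v, r u v → v ≠ t → ∃ w, r v w) {u v : V} (huv : r u v) :
    Relation.ReflTransGen r v t := by
  let s : V → V → Prop := Function.swap (Relation.TransGen r)
  have : IsTrans V s := ⟨fun _ _ _ hab hbc => Relation.TransGen.trans hbc hab⟩
  have : Std.Irrefl s := ⟨hr⟩
  induction v using (Finite.wellFounded_of_trans_of_irrefl s).induction generalizing u with
  | _ v ih =>
    by_cases hv : v = t
    · rw [hv]
    · obtain ⟨w, hw⟩ := hstep u v huv hv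
      exact Relation.ReflTransGen.head hw (ih w (Relation.TransGen.single hw) hw)

theorem Finset.exists_pos_of_sum_univ_pos {V : Type*} [Fintype V] {f : V → ℝ}
    (h : 0 < ∑ j, f j) : ∃ j, 0 < f j := by
  obtain ⟨j, -, hj⟩ := Finset.exists_lt_of_sum_lt (f := fun _ => (0 : ℝ)) (g := f)
    (s := Finset.univ) (by simpa using h)
  exact ⟨j, hj⟩

theorem Finset.sum_univ_pos_of_pos {V : Type*} [Fintype V] {f : V → ℝ} (hf : ∀ j, 0 ≤ f j)
    {j : V} (hj : 0 < f j) : 0 < ∑ j, f j :=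
  Finset.sum_pos' (fun j _ => hf j) ⟨j, Finset.mem_univ j, hj⟩

/-- Path decomposition of an acyclic flow with no arc entering the source or leaving the sink. -/
theorem exists_path_decomposition {V : Type*} [Fintype V] [DecidableEq V]
    {o d : V} (hod : o ≠ d) (x : V → V → ℝ) (hx : ∀ i j, 0 ≤ x i j)
    (hacyc : ∀ i : V, ¬ Relation.TransGen (fun i j => 0 < x i j) i i)
    (ho : ∀ j, x j o = 0) (hd : ∀ j, x d j = 0)
    (hcons : ∀ i, i ≠ o → i ≠ d → ∑ j, x i j = ∑ j, x j i) :
    ∃ (m : ℕ) (p : Fin m → List V) (μ : Fin m → ℝ),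
      (∀ k, (p k).head? = some o ∧ (p k).getLast? = some d ∧ (p k).Nodup ∧
        (p k).IsChain (fun i j => 0 < x i j)) ∧
      (∀ k, 0 ≤ μ k) ∧
      (∀ i j : V, x i j =
        ∑ k, μ k * (if (i, j) ∈ (p k).zip (p k).tail then (1 : ℝ) else 0)) := by
  induction hn : (Finset.univ.filter fun e : V × V => 0 < x e.1 e.2).card
    using Nat.strong_induction_on generalizing x with
  | _ n ih =>
  by_cases hzero : ∀ i j, x i j = 0
  · exact ⟨0, Fin.elim0, Fin.elim0, fun k => k.elim0, fun k => k.elim0, by simpa using hzero⟩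
  push Not at hzero
  obtain ⟨u, v, huv⟩ := hzero
  have huv : 0 < x u v := (hx u v).lt_of_ne' huv
  have hvd : Relation.ReflTransGen (fun i j => 0 < x i j) v d := by
    refine Relation.ReflTransGen.of_acyclic_of_forall_exists hacyc (fun a b hab hb => ?_) huv
    have hbo : b ≠ o := by
      rintro rfl
      exact hab.ne' (ho a)
    apply Finset.exists_pos_of_sum_univ_pos
    rw [hcons b hbo hb]
    exact Finset.sum_univ_pos_of_pos (fun j => hx j b) hab
  have hou : Relation.ReflTransGen (fun i j => 0 < x i j) o u := by
    rw [← Relation.reflTransGen_swap]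
    refine Relation.ReflTransGen.of_acyclic_of_forall_exists (u := v)
      (fun i hi => hacyc i (Relation.transGen_swap.1 hi)) (fun b a hab ha => ?_) huv
    have had : a ≠ d := by
      rintro rfl
      exact hab.ne' (hd b)
    apply Finset.exists_pos_of_sum_univ_pos (f := fun j => x j a)
    rw [← hcons a ha had]
    exact Finset.sum_univ_pos_of_pos (hx a) hab
  obtain ⟨l, hl, hlast⟩ := List.exists_isChain_cons_of_relationReflTransGen
    (hou.trans (Relation.ReflTransGen.head huv hvd))
  have hnodup : (o :: l).Nodup := hl.nodup_of_acyclic hacyc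
  have hne : ((o :: l).zip l).toFinset.Nonempty := by
    cases l with
    | nil => exact absurd hlast hod
    | cons b l => exact ⟨(o, b), by simp⟩
  obtain ⟨e, he, hmin⟩ := Finset.exists_min_image _ (fun e : V × V => x e.1 e.2) hne
  rw [List.mem_toFinset] at he
  have hepos : 0 < x e.1 e.2 := List.rel_of_mem_zip_tail hl he
  set c := x e.1 e.2 with hc
  let I : V → V → ℝ := fun i j => if (i, j) ∈ (o :: l).zip l then 1 else 0
  let y : V → V → ℝ := fun i j => x i j - c * I i j
  have hy : ∀ i j, 0 ≤ y i j := by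
    intro i j
    by_cases h : (i, j) ∈ (o :: l).zip l
    · simpa [y, I, h] using hmin (i, j) (List.mem_toFinset.2 h)
    · simpa [y, I, h] using hx i j
  have hyx : ∀ i j, y i j ≤ x i j := by
    intro i j
    have : 0 ≤ I i j := by dsimp only [I]; split_ifs <;> norm_num
    have := mul_nonneg hepos.le this
    simp only [y]
    linarith
  have hypos : ∀ i j, 0 < y i j → 0 < x i j := fun i j h => h.trans_le (hyx i j)
  have hycons : ∀ i, i ≠ o → i ≠ d → ∑ j, y i j = ∑ j, y j i := by
    intro i hio hid
    have h := hnodup.sum_zip_tail_sub i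
    rw [hlast, if_neg hio, if_neg hid] at h
    simp only [y, I, Finset.sum_sub_distrib, ← Finset.mul_sum, hcons i hio hid]
    rw [sub_eq_sub_iff_sub_eq_sub, sub_self, ← mul_sub, h]
    simp
  have hcard : (Finset.univ.filter fun e : V × V => 0 < y e.1 e.2).card < n := by
    rw [← hn]
    refine Finset.card_lt_card (Finset.ssubset_iff_of_subset ?_ |>.2 ⟨e, ?_, ?_⟩)
    · intro a ha
      simp only [Finset.mem_filter, Finset.mem_univ, true_and] at ha ⊢
      exact hypos _ _ ha
    · simpa using hepos
    · simp [y, I, he, ← hc]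
  obtain ⟨m, p, μ, hp, hμ, hsum⟩ := ih _ hcard y hy
    (fun i hi => hacyc i (Relation.TransGen.mono hypos i i hi))
    (fun j => le_antisymm ((hyx j o).trans (ho j).le) (hy j o))
    (fun j => le_antisymm ((hyx d j).trans (hd j).le) (hy d j)) hycons rfl
  refine ⟨m + 1, Fin.cons (o :: l) p, Fin.cons c μ, ?_, ?_, ?_⟩
  · intro k
    refine Fin.cases ?_ (fun k => ?_) k
    · refine ⟨rfl, ?_, hnodup, hl⟩
      rw [Fin.cons_zero, List.getLast?_eq_some_getLast (by simp), hlast]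
    · rw [Fin.cons_succ]
      obtain ⟨h₁, h₂, h₃, h₄⟩ := hp k
      exact ⟨h₁, h₂, h₃, h₄.imp hypos⟩
  · intro k
    exact Fin.cases hepos.le hμ k
  · intro i j
    rw [Fin.sum_univ_succ]
    simp only [Fin.cons_zero, Fin.cons_succ, List.tail_cons]
    rw [← hsum i j]
    simp only [y, I]
    ring


/-- Flow decomposition underlying the arc-flow/path-flow equivalence (equations (10)–(12)):
a nonnegative arc flow `x` on a finite vertex set, whose support admits no directed cycle
and which satisfies the flow-conservation constraints with source `o`, sink `d`, and
demand `D ≥ 0`, decomposes into finitely many nonnegatively weighted directed `o`–`d`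
paths: lists of distinct vertices starting at `o` and ending at `d` whose consecutive
pairs lie in the support of `x`, with `x i j = Σ_k μ k * 1[(i,j) consecutive in p k]`. -/
theorem flow_decomposition
    {V : Type*} [Fintype V] [DecidableEq V]
    (o d : V) (hod : o ≠ d) (D : ℝ) (hD : 0 ≤ D)
    (x : V → V → ℝ) (hx : ∀ i j, 0 ≤ x i j)
    (hacyc : ∀ i : V, ¬ Relation.TransGen (fun i j => 0 < x i j) i i)
    (hcons : ∀ i : V, (∑ j, x i j) - (∑ j, x j i) =
      if i = o then D else if i = d then -D else 0) :
    ∃ (m : ℕ) (p : Fin m → List V) (μ : Fin m → ℝ),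
      (∀ k, (p k).head? = some o ∧ (p k).getLast? = some d ∧ (p k).Nodup ∧
        (p k).Chain' (fun i j => 0 < x i j)) ∧
      (∀ k, 0 ≤ μ k) ∧
      (∀ i j : V, x i j =
        ∑ k, μ k * (if (i, j) ∈ (p k).zip (p k).tail then (1 : ℝ) else 0)) := by
  have hout_pos : ∀ a b, 0 < x a b → b ≠ d → ∃ w, 0 < x b w := by
    intro a b hab hb
    have h := hcons b
    have hin := Finset.sum_univ_pos_of_pos (fun j => hx j b) hab
    apply Finset.exists_pos_of_sum_univ_pos
    rw [if_neg hb] at h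
    split_ifs at h <;> linarith
  have hin_pos : ∀ b a, 0 < x a b → a ≠ o → ∃ w, 0 < x w a := by
    intro b a hab ha
    have h := hcons a
    have hout := Finset.sum_univ_pos_of_pos (hx a) hab
    apply Finset.exists_pos_of_sum_univ_pos (f := fun w => x w a)
    rw [if_neg ha] at h
    split_ifs at h <;> linarith
  have ho : ∀ j, x j o = 0 := by
    intro j
    by_contra hj
    have hj : 0 < x j o := (hx j o).lt_of_ne' hj
    have hreach : Relation.ReflTransGen (fun i j => 0 < x i j) o j := by
      rw [← Relation.reflTransGen_swap]
      exact Relation.ReflTransGen.of_acyclic_of_forall_exists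
        (fun i hi => hacyc i (Relation.transGen_swap.1 hi)) hin_pos hj
    exact hacyc o (Relation.TransGen.tail' hreach hj)
  have hd : ∀ j, x d j = 0 := by
    intro j
    by_contra hj
    have hj : 0 < x d j := (hx d j).lt_of_ne' hj
    exact hacyc d (Relation.TransGen.head' hj
      (Relation.ReflTransGen.of_acyclic_of_forall_exists hacyc hout_pos hj))
  exact exists_path_decomposition hod x hx hacyc ho hd fun i hio hid => by
    simpa [hio, hid, sub_eq_zero] using hcons i
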